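/- arXiv:1107.0672 — 2 statements merged into one kernel-verified Lean document; each statement's English description precedes it below -/
import Mathlib

section
/- Let G be a group and let β ∈ G be an element of infinite order. Suppose there is a surjective group homomorphism ω from the centralizer C_G(β) = {g ∈ G | gβ = βg} onto ℤ whose kernel is finite. Then the set of roots of β in G, namely {γ ∈ G | γ^m = β for some positive integer m}, is finite. -/
/-- The fibres of a group homomorphism with finite kernel are finite. -/
theorem MonoidHom.finite_fiber_of_finite_ker {H K : Type*} [Group H] [Group K] (f : H →* K)
    (hker : Finite f.ker) (y : K) : (f ⁻¹' {y}).Finite := by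
  rcases (f ⁻¹' {y}).eq_empty_or_nonempty with h | ⟨x, hx⟩
  · exact h ▸ Set.finite_empty
  · refine ((Set.toFinite (f.ker : Set H)).image (x * ·)).subset fun z hz ↦ ⟨x⁻¹ * z, ?_, by simp⟩
    simp_all [MonoidHom.mem_ker]

/-- A homomorphism with finite kernel sends elements of infinite order to nontrivial elements. -/
theorem MonoidHom.map_ne_one_of_finite_ker {H K : Type*} [Group H] [Group K] (f : H →* K)
    (hker : Finite f.ker) {x : H} (hx : ¬ IsOfFinOrder x) : f x ≠ 1 := fun h ↦
  hx <| Submonoid.isOfFinOrder_coe.2 (isOfFinOrder_of_finite (⟨x, h⟩ : f.ker))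

/-- If `β ∈ G` has infinite order and its centralizer admits a surjective
homomorphism onto `ℤ` with finite kernel, then `β` has only finitely many
roots in `G`. -/
theorem roots_finite {G : Type*} [Group G] (β : G)
    (hβ : ∀ m : ℕ, 0 < m → β ^ m ≠ 1)
    (ω : Subgroup.centralizer {β} →* Multiplicative ℤ)
    (hω : Function.Surjective ω) (hker : Finite ω.ker) :
    {γ : G | ∃ m : ℕ, 0 < m ∧ γ ^ m = β}.Finite := by
  let b : Subgroup.centralizer {β} := ⟨β, Subgroup.mem_centralizer_singleton_iff.2 rfl⟩
  have hb : ¬ IsOfFinOrder b := by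
    rw [← Submonoid.isOfFinOrder_coe, isOfFinOrder_iff_pow_eq_one]
    rintro ⟨m, hm, h⟩
    exact hβ m hm h
  have hk : (ω b).toAdd ≠ 0 := ω.map_ne_one_of_finite_ker hker hb
  have hfin : (Multiplicative.toAdd ⁻¹' Set.Icc (-|(ω b).toAdd|) |(ω b).toAdd|).Finite :=
    (Set.finite_Icc _ _).preimage Multiplicative.toAdd.injective.injOn
  refine ((hfin.preimage' fun y _ ↦ ω.finite_fiber_of_finite_ker hker y).image
    Subtype.val).subset ?_
  rintro γ ⟨m, -, hγ⟩
  have hc : γ ∈ Subgroup.centralizer {β} := by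
    rw [Subgroup.mem_centralizer_singleton_iff, ← hγ, ← pow_succ, ← pow_succ']
  refine ⟨⟨γ, hc⟩, ?_, rfl⟩
  have hpow : (⟨γ, hc⟩ : Subgroup.centralizer {β}) ^ m = b := Subtype.ext hγ
  have hdvd : (ω ⟨γ, hc⟩).toAdd ∣ (ω b).toAdd := ⟨m, by
    rw [← hpow, map_pow, toAdd_pow, nsmul_eq_mul, mul_comm]⟩
  exact abs_le.1 (Int.le_of_dvd (abs_pos.2 hk) ((abs_dvd_abs _ _).2 hdvd))
end

section
/- Let m ≥ 2 and let X = ℕ → Fin 2 be Cantor space with the product topology (Fin 2 discrete). The group C(X, ZMod m) of continuous maps from X to the finite cyclic group ZMod m (equipped with the discrete topology), under pointwise addition, is not finitely generated. -/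
/-- The `n`-th coordinate of a binary sequence, as a continuous map to `ZMod m`. -/
def coordinateMap (m : ℕ) [TopologicalSpace (ZMod m)] (n : ℕ) : C((ℕ → Fin 2), ZMod m) where
  toFun x := ((x n : ℕ) : ZMod m)
  continuous_toFun :=
    (continuous_of_discreteTopology (f := fun i : Fin 2 => ((i : ℕ) : ZMod m))).comp
      (continuous_apply n)

theorem coordinateMap_injective (m : ℕ) [Fact (1 < m)] [TopologicalSpace (ZMod m)] :
    Function.Injective (coordinateMap m) := by
  intro a b hab
  by_contra hne
  have h := DFunLike.congr_fun hab (Pi.single a 1)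
  simp [coordinateMap, Pi.single_eq_of_ne' hne] at h

/-- The group of continuous maps from Cantor space to the discrete cyclic group
`ZMod m` (`m ≥ 2`), under pointwise addition, is not finitely generated. -/
theorem maps_to_zmod_not_fg (m : ℕ) (hm : 2 ≤ m) :
    letI : TopologicalSpace (ZMod m) := ⊥
    ¬ AddGroup.FG C((ℕ → Fin 2), ZMod m) := by
  let : TopologicalSpace (ZMod m) := ⊥
  have : DiscreteTopology (ZMod m) := ⟨rfl⟩
  have : Fact (1 < m) := ⟨hm⟩
  intro hfg
  have htorsion : IsAddTorsion C((ℕ → Fin 2), ZMod m) := fun f =>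
    isOfFinAddOrder_iff_nsmul_eq_zero.2 ⟨m, by omega, by ext x; simp⟩
  have : Finite C((ℕ → Fin 2), ZMod m) := AddCommGroup.finite_of_fg_isAddTorsion _ htorsion
  exact not_injective_infinite_finite _ (coordinateMap_injective m)
end
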